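/- arXiv:math/0701541 — 4 statements merged into one kernel-verified Lean document; each statement's English description precedes it below -/
import Mathlib

section
/- Let s ∈ (0,1), let I : E_A^∞ → ℝ be Hölder continuous with I(ω) ≥ −log s for all ω, and let J : E_A^∞ → ℝ^d be bounded and Hölder continuous. If E_A^∞ is nonempty and finitely irreducible, then the set K := {α ∈ ℝ^d : there exists ω ∈ E_A^∞ with lim_{n→∞} S_nJ(ω)/S_nI(ω) = α} is a compact subset of ℝ^d. -/
open MeasureTheory Filter Topology

/-- The one-sided subshift `E_A^∞` over the alphabet `E` with incidence matrix `A`. -/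
abbrev Subshift (E : Type*) (A : E → E → Bool) : Type _ :=
  {ω : ℕ → E // ∀ i : ℕ, A (ω i) (ω (i + 1)) = true}

/-- The left shift map `σ` on `E_A^∞`. -/
def shiftMap {E : Type*} {A : E → E → Bool} (ω : Subshift E A) : Subshift E A :=
  ⟨fun i => ω.1 (i + 1), fun i => ω.2 (i + 1)⟩

/-- The `n`-th Birkhoff sum `S_n f = ∑_{k=0}^{n-1} f ∘ σ^k`. -/
noncomputable def birkSum {E : Type*} {A : E → E → Bool} {X : Type*} [AddCommMonoid X]
    (f : Subshift E A → X) (n : ℕ) (ω : Subshift E A) : X :=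
  ∑ k ∈ Finset.range n, f (shiftMap^[k] ω)

/-- `f` is Hölder continuous with exponent `a > 0`:
`sup_{n ≥ 1} sup { ‖f ω - f τ‖ e^{a(n-1)} : ω, τ agree in their first n coordinates } < ∞`. -/
def IsHolder {E : Type*} {A : E → E → Bool} {X : Type*} [SeminormedAddGroup X]
    (f : Subshift E A → X) (a : ℝ) : Prop :=
  ∃ v : ℝ, ∀ n : ℕ, 1 ≤ n → ∀ ω τ : Subshift E A,
    (∀ i < n, ω.1 i = τ.1 i) → ‖f ω - f τ‖ * Real.exp (a * ((n : ℝ) - 1)) ≤ v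

/-- `E_A^∞` is finitely irreducible: there is a finite set `W` of admissible words such that
any two letters can be joined by a word from `W`. -/
def FinitelyIrreducible {E : Type*} (A : E → E → Bool) : Prop :=
  ∃ W : Finset (List E), ∀ a b : E,
    ∃ w ∈ W, List.Chain' (fun x y => A x y = true) (a :: (w ++ [b]))


section Aux

variable {E : Type*} {A : E → E → Bool} {X : Type*} [NormedAddCommGroup X]

lemma shiftMap_iter_val (k : ℕ) (ω : Subshift E A) (i : ℕ) :
    (shiftMap^[k] ω).1 i = ω.1 (i + k) := by
  induction k generalizing ω with
  | zero => rfl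
  | succ k ih =>
    rw [Function.iterate_succ_apply, ih]
    show ω.1 (i + k + 1) = _
    rfl

lemma birkSum_add (f : Subshift E A → X) (m n : ℕ) (ω : Subshift E A) :
    birkSum f (m + n) ω = birkSum f m ω + birkSum f n (shiftMap^[m] ω) := by
  unfold birkSum
  rw [Finset.sum_range_add]
  congr 1
  refine Finset.sum_congr rfl fun k _ => ?_
  rw [← Function.iterate_add_apply, add_comm]

lemma birkSum_zero (f : Subshift E A → X) (ω : Subshift E A) : birkSum f 0 ω = 0 := by
  simp [birkSum]

lemma birkSum_one (f : Subshift E A → X) (ω : Subshift E A) : birkSum f 1 ω = f ω := by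
  simp [birkSum]

/-- bounded distortion -/
def Distort (f : Subshift E A → X) (D : ℝ) : Prop :=
  ∀ m : ℕ, ∀ ω τ : Subshift E A, (∀ i < m, ω.1 i = τ.1 i) →
    ‖birkSum f m ω - birkSum f m τ‖ ≤ D

lemma distort_of_holder (f : Subshift E A → X) (a : ℝ) (ha : 0 < a) (hf : IsHolder f a) :
    ∃ D, Distort f D := by
  obtain ⟨v, hv⟩ := hf
  refine ⟨|v| * (1 - Real.exp (-a))⁻¹, fun m ω τ h => ?_⟩
  have hr1 : Real.exp (-a) < 1 := by rw [Real.exp_lt_one_iff]; linarith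
  have hr0 := Real.exp_pos (-a)
  unfold birkSum
  rw [← Finset.sum_sub_distrib]
  calc ‖∑ k ∈ Finset.range m, (f (shiftMap^[k] ω) - f (shiftMap^[k] τ))‖
      ≤ ∑ k ∈ Finset.range m, ‖f (shiftMap^[k] ω) - f (shiftMap^[k] τ)‖ := norm_sum_le _ _
    _ ≤ ∑ k ∈ Finset.range m, |v| * Real.exp (-a) ^ (m - 1 - k) := by
        refine Finset.sum_le_sum fun k hk => ?_
        have hk := Finset.mem_range.1 hk
        have := hv (m - k) (by omega) (shiftMap^[k] ω) (shiftMap^[k] τ) (fun i hi => by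
          rw [shiftMap_iter_val, shiftMap_iter_val]; exact h _ (by omega))
        have e : Real.exp (-a) ^ (m - 1 - k) = (Real.exp (a * (((m - k : ℕ) : ℝ) - 1)))⁻¹ := by
          rw [← Real.exp_nat_mul, ← Real.exp_neg]
          congr 1
          have : m - k = (m - 1 - k) + 1 := by omega
          rw [this]; push_cast; ring
        rw [e, ← div_eq_mul_inv, le_div_iff₀ (Real.exp_pos _)]
        exact this.trans (le_abs_self v)
    _ = ∑ k ∈ Finset.range m, |v| * Real.exp (-a) ^ k :=
        Finset.sum_range_reflect (fun k => |v| * Real.exp (-a) ^ k) m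
    _ ≤ |v| * (1 - Real.exp (-a))⁻¹ := by
        rw [← Finset.mul_sum]
        refine mul_le_mul_of_nonneg_left ?_ (abs_nonneg v)
        rw [← tsum_geometric_of_lt_one hr0.le hr1]
        exact (summable_geometric_of_lt_one hr0.le hr1).sum_le_tsum _
          (fun i _ => pow_nonneg hr0.le i)

lemma exists_letter_bound (g : Subshift E A → X) (D : ℝ) (hD : Distort g D) :
    ∃ h : E → ℝ, (∀ e, 0 ≤ h e) ∧ ∀ ω, ‖g ω‖ ≤ h (ω.1 0) := by
  have : ∀ e : E, ∃ b : ℝ, 0 ≤ b ∧ ∀ ω : Subshift E A, ω.1 0 = e → ‖g ω‖ ≤ b := by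
    intro e
    by_cases he : ∃ ω : Subshift E A, ω.1 0 = e
    · obtain ⟨ω0, h0⟩ := he
      have key : ∀ ω : Subshift E A, ω.1 0 = e → ‖g ω‖ ≤ ‖g ω0‖ + D := by
        intro ω hω
        have := hD 1 ω ω0 (fun i hi => by
          obtain rfl : i = 0 := by omega
          rw [hω, h0])
        rw [birkSum_one, birkSum_one] at this
        have h2 := norm_sub_norm_le (g ω) (g ω0)
        linarith
      exact ⟨_, (norm_nonneg _).trans (key ω0 h0), key⟩
    · exact ⟨0, le_rfl, fun ω hω => (he ⟨ω, hω⟩).elim⟩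
  choose h h0 h1 using this
  exact ⟨h, h0, fun ω => h1 _ ω rfl⟩

/-- initial word of length `m` of `τ` followed by `ω` -/
lemma exists_splice (τ ω : Subshift E A) (m : ℕ)
    (h : ∀ k, m = k + 1 → A (τ.1 k) (ω.1 0) = true) :
    ∃ τ' : Subshift E A, (∀ i < m, τ'.1 i = τ.1 i) ∧ shiftMap^[m] τ' = ω := by
  refine ⟨⟨fun i => if i < m then τ.1 i else ω.1 (i - m), fun i => ?_⟩, fun i hi => ?_, ?_⟩
  · dsimp only
    by_cases h1 : i + 1 < m
    · rw [if_pos (by omega), if_pos h1]; exact τ.2 i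
    · by_cases h2 : i < m
      · rw [if_pos h2, if_neg h1]
        have : m = i + 1 := by omega
        rw [show i + 1 - m = 0 by omega]
        exact h i this
      · rw [if_neg h2, if_neg h1, show i + 1 - m = (i - m) + 1 by omega]
        exact ω.2 _
  · simp [hi]
  · apply Subtype.ext
    funext i
    rw [shiftMap_iter_val]
    simp

lemma exists_cons (e : E) (ω : Subshift E A) (h : A e (ω.1 0) = true) :
    ∃ τ : Subshift E A, τ.1 0 = e ∧ shiftMap τ = ω := by
  refine ⟨⟨fun i => Nat.casesOn i e ω.1, fun i => ?_⟩, rfl, rfl⟩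
  cases i with
  | zero => exact h
  | succ i => exact ω.2 i

lemma exists_bridge_word (g : Subshift E A → X) (h : E → ℝ) (h0 : ∀ e, 0 ≤ h e)
    (hg : ∀ ω, ‖g ω‖ ≤ h (ω.1 0)) (ω : Subshift E A) (w : List E) :
    ∀ a : E, List.IsChain (fun x y => A x y = true) (a :: (w ++ [ω.1 0])) →
    ∃ (ω1 : Subshift E A) (p : ℕ), shiftMap^[p] ω1 = ω ∧ A a (ω1.1 0) = true ∧
      ∀ j ≤ p, ‖birkSum g j ω1‖ ≤ (w.map h).sum := by
  induction w with
  | nil =>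
    intro a ha
    refine ⟨ω, 0, rfl, ?_, fun j hj => ?_⟩
    · simpa using ha
    · obtain rfl : j = 0 := by omega
      simp [birkSum]
  | cons e w ih =>
    intro a ha
    rw [List.cons_append, List.isChain_cons_cons] at ha
    obtain ⟨ω1, p, h1, h2, h3⟩ := ih e ha.2
    obtain ⟨ω2, h4, h5⟩ := exists_cons e ω1 h2
    refine ⟨ω2, p + 1, ?_, ?_, ?_⟩
    · rw [Function.iterate_succ_apply, h5, h1]
    · rw [h4]; exact ha.1
    · intro j hj
      rw [List.map_cons, List.sum_cons]
      cases j with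
      | zero =>
        rw [birkSum_zero, norm_zero]
        have := (norm_nonneg _).trans (h3 0 (by omega))
        linarith [h0 e]
      | succ j =>
        rw [add_comm j 1, birkSum_add, birkSum_one]
        refine (norm_add_le _ _).trans (add_le_add ?_ ?_)
        · have := hg ω2; rwa [h4] at this
        · rw [Function.iterate_one, h5]; exact h3 j (by omega)

lemma exists_bridge (hfi : FinitelyIrreducible A) (g : Subshift E A → X) (D : ℝ)
    (hD : Distort g D) :
    ∃ Q : ℝ, ∀ (a : E) (ω : Subshift E A),
    ∃ (ω1 : Subshift E A) (p : ℕ), shiftMap^[p] ω1 = ω ∧ A a (ω1.1 0) = true ∧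
      ∀ j ≤ p, ‖birkSum g j ω1‖ ≤ Q := by
  obtain ⟨h, h0, hg⟩ := exists_letter_bound g D hD
  obtain ⟨W, hW⟩ := hfi
  refine ⟨∑ w ∈ W, (w.map h).sum, fun a ω => ?_⟩
  obtain ⟨w, hw, hc⟩ := hW a (ω.1 0)
  obtain ⟨ω1, p, h1, h2, h3⟩ := exists_bridge_word g h h0 hg ω w a hc
  refine ⟨ω1, p, h1, h2, fun j hj => (h3 j hj).trans ?_⟩
  refine Finset.single_le_sum (f := fun w : List E => (w.map h).sum) (fun w _ => ?_) hw
  apply List.sum_nonneg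
  intro x hx
  obtain ⟨e, _, rfl⟩ := List.mem_map.1 hx
  exact h0 e

/-- `‖S_n g τ‖ ≤ ε S_n I τ + C` -/
def Good (g : Subshift E A → X) (I : Subshift E A → ℝ) (τ : Subshift E A) (ε : ℝ) : Prop :=
  ∃ C : ℝ, ∀ n, ‖birkSum g n τ‖ ≤ ε * birkSum I n τ + C

lemma birkSum_ge (I : Subshift E A → ℝ) (c : ℝ) (hI : ∀ ω, c ≤ I ω) (n : ℕ)
    (ω : Subshift E A) : c * n ≤ birkSum I n ω := by
  have := Finset.card_nsmul_le_sum (Finset.range n) (fun k => I (shiftMap^[k] ω)) c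
    (fun k _ => hI _)
  simpa [birkSum, mul_comm] using this

lemma good_shift (g : Subshift E A → X) (I : Subshift E A → ℝ) (hI : ∀ ω, 0 ≤ I ω)
    (ε : ℝ) (hε : 0 ≤ ε) (q : ℕ) (τ : Subshift E A)
    (h : Good g I (shiftMap^[q] τ) ε) : Good g I τ ε := by
  induction q generalizing τ with
  | zero => exact h
  | succ q ih =>
    rw [Function.iterate_succ_apply] at h
    obtain ⟨C, hC⟩ := ih _ h
    have hC0 : 0 ≤ C := by
      have := hC 0
      simpa [birkSum_zero] using this
    refine ⟨‖g τ‖ + C, fun n => ?_⟩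
    cases n with
    | zero => simp only [birkSum_zero, norm_zero, mul_zero]; positivity
    | succ n =>
      rw [add_comm n 1, birkSum_add, birkSum_add, birkSum_one, birkSum_one]
      have h1 := norm_add_le (g τ) (birkSum g n (shiftMap^[1] τ))
      have h2 := hC n
      rw [Function.iterate_one] at *
      have := mul_nonneg hε (hI τ)
      linarith

lemma step (g : Subshift E A → X) (I : Subshift E A → ℝ) (c D Q : ℝ) (hc : 0 < c)
    (hI : ∀ ω, c ≤ I ω) (hDg : Distort g D) (hDI : Distort I D)
    (hQ : ∀ (a : E) (ω : Subshift E A),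
      ∃ (ω1 : Subshift E A) (p : ℕ), shiftMap^[p] ω1 = ω ∧ A a (ω1.1 0) = true ∧
      ∀ j ≤ p, ‖birkSum g j ω1‖ ≤ Q)
    (ε ε' : ℝ) (hε' : 0 < ε') (hεε : ε' ≤ ε) (τ ω : Subshift E A)
    (hτ : Good g I τ ε) (hω : Good g I ω ε') (B : ℕ) :
    ∃ (τ' : Subshift E A) (m : ℕ), B < m ∧ (∀ i < m, τ'.1 i = τ.1 i) ∧ Good g I τ' ε' ∧
      ∀ n, m ≤ n → ‖birkSum g n τ'‖ ≤ 2 * ε * birkSum I n τ' := by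
  have hε : 0 < ε := hε'.trans_le hεε
  have hI0 : ∀ ω, 0 ≤ I ω := fun ω => hc.le.trans (hI ω)
  obtain ⟨C1, hC1⟩ := hτ
  obtain ⟨C2, hC2⟩ := id hω
  have hC20 : 0 ≤ C2 := by
    have := hC2 0
    simpa [birkSum_zero] using this
  obtain ⟨N, hN⟩ := exists_nat_gt ((C1 + ε * D + D + C2 + Q) / (ε * c))
  rw [div_lt_iff₀ (by positivity)] at hN
  set m := max N B + 1 with hm
  obtain ⟨ω1, p, h1, h2, h3⟩ := hQ (τ.1 (max N B)) ω
  obtain ⟨τ', h4, h5⟩ := exists_splice τ ω1 m (fun k hk => by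
    obtain rfl : max N B = k := by omega
    exact h2)
  have hS0 : ∀ n ω, 0 ≤ birkSum I n ω := fun n ω => Finset.sum_nonneg fun k _ => hI0 _
  have hω1 : ∀ j, ‖birkSum g j ω1‖ ≤ ε * birkSum I j ω1 + C2 + Q := by
    intro j
    rcases le_total j p with hj | hj
    · have := h3 j hj
      have := mul_nonneg hε.le (hS0 j ω1)
      linarith
    · obtain ⟨i, rfl⟩ := Nat.exists_eq_add_of_le hj
      rw [birkSum_add, birkSum_add, h1]
      have e1 := norm_add_le (birkSum g p ω1) (birkSum g i ω)
      have e2 := h3 p le_rfl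
      have e3 := hC2 i
      have e4 := mul_nonneg hε.le (hS0 p ω1)
      have e5 := mul_le_mul_of_nonneg_right hεε (hS0 i ω)
      linarith
  refine ⟨τ', m, by omega, h4, ?_, ?_⟩
  · apply good_shift g I hI0 ε' hε'.le (p + m)
    rw [Function.iterate_add_apply, h5, h1]
    exact hω
  · intro n hn
    obtain ⟨j, rfl⟩ := Nat.exists_eq_add_of_le hn
    have e0 := birkSum_ge I c hI (m + j) τ'
    have e1 : (N : ℝ) ≤ ((m + j : ℕ) : ℝ) := by
      exact_mod_cast (show N ≤ m + j by omega)
    have e2 : (N : ℝ) * (ε * c) ≤ ε * birkSum I (m + j) τ' := by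
      calc (N : ℝ) * (ε * c) ≤ ((m + j : ℕ) : ℝ) * (ε * c) := by gcongr
        _ = ε * (c * ((m + j : ℕ) : ℝ)) := by ring
        _ ≤ _ := by gcongr
    rw [birkSum_add I m j, h5] at e2
    rw [birkSum_add g m j, birkSum_add I m j, h5]
    have f1 := norm_add_le (birkSum g m τ') (birkSum g j ω1)
    have f2 := hω1 j
    have f3 := hDg m τ' τ h4
    have f4 := hDI m τ' τ h4
    rw [Real.norm_eq_abs, abs_le] at f4
    have f5 := norm_sub_norm_le (birkSum g m τ') (birkSum g m τ)
    have f6 := hC1 m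
    have f7 : ε * birkSum I m τ ≤ ε * (birkSum I m τ' + D) := by
      apply mul_le_mul_of_nonneg_left _ hε.le
      linarith [f4.1]
    nlinarith

lemma core (hfi : FinitelyIrreducible A) (g : Subshift E A → X) (I : Subshift E A → ℝ)
    (c D : ℝ) (hc : 0 < c)
    (hI : ∀ ω, c ≤ I ω) (hDg : Distort g D) (hDI : Distort I D)
    (hgood : ∀ ε > 0, ∃ ω, Good g I ω ε) :
    ∃ τ, ∀ ε > 0, ∀ᶠ n in atTop, ‖birkSum g n τ‖ ≤ ε * birkSum I n τ := by
  obtain ⟨Q, hQ⟩ := exists_bridge hfi g D hDg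
  let e : ℕ → ℝ := fun k => 1 / ((k : ℝ) + 1)
  have he : ∀ k, 0 < e k := fun k => by positivity
  have heanti : Antitone e := fun a b hab => one_div_le_one_div_of_le (by positivity) (by
    have : (a : ℝ) ≤ b := by exact_mod_cast hab
    linarith)
  choose W hW using fun k => hgood (e k) (he k)
  -- the recursive construction
  have hstep : ∀ (k : ℕ) (x : {τ : Subshift E A // Good g I τ (e k)} × ℕ),
      ∃ y : {τ : Subshift E A // Good g I τ (e (k + 1))} × ℕ, x.2 < y.2 ∧
        (∀ i < y.2, y.1.1.1 i = x.1.1.1 i) ∧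
        ∀ n, y.2 ≤ n → ‖birkSum g n y.1.1‖ ≤ 2 * e k * birkSum I n y.1.1 := by
    intro k x
    obtain ⟨τ', m, h1, h2, h3, h4⟩ := step g I c D Q hc hI hDg hDI hQ (e k) (e (k + 1)) (he _)
      (heanti (Nat.le_succ k)) x.1.1 (W (k + 1)) x.1.2 (hW _) x.2
    exact ⟨⟨⟨τ', h3⟩, m⟩, h1, h2, h4⟩
  choose nxt hn1 hn2 hn3 using hstep
  let s : ∀ k : ℕ, {τ : Subshift E A // Good g I τ (e k)} × ℕ :=
    fun k => Nat.rec ⟨⟨W 0, hW 0⟩, 0⟩ nxt k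
  have hs : ∀ k, s (k + 1) = nxt k (s k) := fun k => rfl
  let T : ℕ → Subshift E A := fun k => (s k).1.1
  let m : ℕ → ℕ := fun k => (s (k + 1)).2
  have hmT : ∀ k, ∀ i < m k, (T (k + 1)).1 i = (T k).1 i := fun k => by
    intro i hi
    exact hn2 k (s k) i hi
  have hmm : StrictMono m := strictMono_nat_of_lt_succ fun k => hn1 (k + 1) (s (k + 1))
  have hT3 : ∀ k n, m k ≤ n → ‖birkSum g n (T (k + 1))‖ ≤ 2 * e k * birkSum I n (T (k + 1)) :=
    fun k n h => hn3 k (s k) n h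
  have hm0 : ∀ k, k < m k := by
    intro k
    induction k with
    | zero => exact hn1 0 (s 0)
    | succ k ih => have := hmm (Nat.lt_succ_self k); simp only [Nat.succ_eq_add_one] at this; omega
  have hagree : ∀ k j, k ≤ j → ∀ i < m k, (T j).1 i = (T k).1 i := by
    intro k j hkj
    induction j, hkj using Nat.le_induction with
    | base => intro i _; rfl
    | succ j hj ih =>
      intro i hi
      rw [hmT j i (hi.trans_le (hmm.monotone hj)), ih i hi]
  let t : ℕ → E := fun i => (T i).1 i
  have ht : ∀ k, ∀ i < m k, t i = (T k).1 i := by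
    intro k i hi
    rcases le_total i k with h | h
    · exact (hagree i k h i (hm0 i)).symm
    · exact hagree k i h i hi
  let τ : Subshift E A := ⟨t, fun i => by
    rw [ht (i + 1) i ((Nat.lt_succ_self i).trans (hm0 _)), ht (i + 1) (i + 1) (hm0 _)]
    exact (T (i + 1)).2 i⟩
  have hD0 : 0 ≤ D := (norm_nonneg _).trans (hDg 0 τ τ (fun _ _ => rfl))
  have hblock : ∀ k n, m k ≤ n → n ≤ m (k + 1) →
      ‖birkSum g n τ‖ ≤ 2 * e k * birkSum I n τ + 3 * D := by
    intro k n h1 h2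
    have ha : ∀ i < n, τ.1 i = (T (k + 1)).1 i := fun i hi => ht (k + 1) i (hi.trans_le h2)
    have f1 := hDg n τ _ ha
    have f2 := hDI n τ _ ha
    rw [Real.norm_eq_abs, abs_le] at f2
    have f3 := norm_sub_norm_le (birkSum g n τ) (birkSum g n (T (k + 1)))
    have f4 := hT3 k n h1
    have f5 : 2 * e k * birkSum I n (T (k + 1)) ≤ 2 * e k * (birkSum I n τ + D) := by
      apply mul_le_mul_of_nonneg_left _ (by linarith [he k])
      linarith [f2.1]
    have f6 : e k ≤ 1 := by
      have := heanti (Nat.zero_le k)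
      simpa [e] using this
    have f7 := mul_le_mul_of_nonneg_right f6 hD0
    linarith
  have hS0 : ∀ n ω, 0 ≤ birkSum I n ω :=
    fun n ω => Finset.sum_nonneg fun k _ => hc.le.trans (hI _)
  have hall : ∀ k n, m k ≤ n → ‖birkSum g n τ‖ ≤ 2 * e k * birkSum I n τ + 3 * D := by
    intro k n h1
    have : ∀ j, k ≤ j → n ≤ m j → ‖birkSum g n τ‖ ≤ 2 * e k * birkSum I n τ + 3 * D := by
      intro j hj
      induction j, hj using Nat.le_induction with
      | base =>
        intro h
        exact hblock k n h1 (h.trans (hmm.monotone (Nat.le_succ k)))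
      | succ j hj ih =>
        intro h
        rcases le_total n (m j) with h' | h'
        · exact ih h'
        · have q1 := hblock j n h' h
          have q2 := mul_le_mul_of_nonneg_right (heanti hj) (hS0 n τ)
          linarith
    exact this (max k n) (le_max_left _ _) ((le_max_right k n).trans (hm0 _).le)
  refine ⟨τ, fun ε hε => ?_⟩
  obtain ⟨k, hk⟩ := exists_nat_one_div_lt (show (0 : ℝ) < ε / 4 by positivity)
  obtain ⟨N, hN⟩ := exists_nat_gt (3 * D / (ε / 2 * c))
  rw [div_lt_iff₀ (by positivity)] at hN
  filter_upwards [eventually_ge_atTop (max N (m k))] with n hn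
  have g1 := hall k n ((le_max_right _ _).trans hn)
  have g2 := birkSum_ge I c hI n τ
  have g3 : (N : ℝ) ≤ n := by exact_mod_cast (le_max_left _ _).trans hn
  have g4 : (N : ℝ) * (ε / 2 * c) ≤ ε / 2 * birkSum I n τ := by
    calc (N : ℝ) * (ε / 2 * c) ≤ n * (ε / 2 * c) := by gcongr
      _ = ε / 2 * (c * n) := by ring
      _ ≤ _ := by gcongr
  have g5 : e k * birkSum I n τ ≤ ε / 4 * birkSum I n τ :=
    mul_le_mul_of_nonneg_right hk.le (hS0 n τ)
  linarith

end Aux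

/-- under the stated hypotheses the set
`K = {α ∈ ℝ^d : ∃ ω ∈ E_A^∞, S_nJ(ω)/S_nI(ω) → α}` is compact. -/
theorem compact_K {E : Type*} [Countable E] (A : E → E → Bool) (d : ℕ)
    (hne : Nonempty (Subshift E A)) (hfi : FinitelyIrreducible A)
    (s : ℝ) (hs : s ∈ Set.Ioo (0 : ℝ) 1)
    (I : Subshift E A → ℝ) (aI : ℝ) (haI : 0 < aI) (hIhold : IsHolder I aI)
    (hIlb : ∀ ω, -Real.log s ≤ I ω)
    (J : Subshift E A → EuclideanSpace ℝ (Fin d)) (aJ : ℝ) (haJ : 0 < aJ)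
    (hJhold : IsHolder J aJ) (hJbdd : ∃ C : ℝ, ∀ ω, ‖J ω‖ ≤ C) :
    IsCompact {α : EuclideanSpace ℝ (Fin d) | ∃ ω : Subshift E A,
      Tendsto (fun n => (birkSum I n ω)⁻¹ • birkSum J n ω) atTop (𝓝 α)} := by
  classical
  have hc : 0 < -Real.log s := by
    have := Real.log_neg hs.1 hs.2
    linarith
  set c := -Real.log s with hcdef
  obtain ⟨C, hC⟩ := hJbdd
  have hSge := birkSum_ge I c hIlb
  have hS0 : ∀ n ω, 0 ≤ birkSum I n ω := fun n ω => (by positivity : 0 ≤ c * n).trans (hSge n ω)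
  have hSpos : ∀ n ω, 0 < n → 0 < birkSum I n ω := fun n ω hn =>
    (by positivity : 0 < c * n).trans_le (hSge n ω)
  rw [Metric.isCompact_iff_isClosed_bounded]
  constructor
  · rw [← isSeqClosed_iff_isClosed]
    intro x α hx hxα
    obtain ⟨DI, hDI⟩ := distort_of_holder I aI haI hIhold
    obtain ⟨DJ, hDJ⟩ := distort_of_holder J aJ haJ hJhold
    let g : Subshift E A → EuclideanSpace ℝ (Fin d) := fun ω => J ω - I ω • α
    have hg : ∀ n ω, birkSum g n ω = birkSum J n ω - birkSum I n ω • α := by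
      intro n ω
      simp only [birkSum, g, Finset.sum_sub_distrib, Finset.sum_smul]
    obtain ⟨ω0⟩ := hne
    have hDI0 : 0 ≤ DI := (norm_nonneg _).trans (hDI 0 ω0 ω0 (fun _ _ => rfl))
    have hDJ0 : 0 ≤ DJ := (norm_nonneg _).trans (hDJ 0 ω0 ω0 (fun _ _ => rfl))
    have hDg : Distort g (max DI (DJ + DI * ‖α‖)) := by
      intro m ω τ h
      refine le_trans ?_ (le_max_right _ _)
      rw [hg, hg, show birkSum J m ω - birkSum I m ω • α - (birkSum J m τ - birkSum I m τ • α)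
        = (birkSum J m ω - birkSum J m τ) - (birkSum I m ω - birkSum I m τ) • α by
          rw [sub_smul]; abel]
      refine (norm_sub_le _ _).trans (add_le_add (hDJ m ω τ h) ?_)
      rw [norm_smul]
      exact mul_le_mul_of_nonneg_right (hDI m ω τ h) (norm_nonneg _)
    have hDI' : Distort I (max DI (DJ + DI * ‖α‖)) :=
      fun m ω τ h => (hDI m ω τ h).trans (le_max_left _ _)
    obtain ⟨τ, hτ⟩ := core hfi g I c _ hc hIlb hDg hDI' (by
      intro ε hε
      obtain ⟨k, hk⟩ := (Metric.tendsto_atTop.1 hxα (ε / 2) (by positivity))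
      have hk := hk k le_rfl
      obtain ⟨ω, hω⟩ := hx k
      refine ⟨ω, ?_⟩
      obtain ⟨N, hN⟩ := Metric.tendsto_atTop.1 hω (ε / 2) (by positivity)
      refine ⟨∑ n ∈ Finset.range (N + 1), ‖birkSum g n ω‖, fun n => ?_⟩
      by_cases hn : n < N + 1
      · have h1 := Finset.single_le_sum (f := fun n => ‖birkSum g n ω‖)
          (fun i _ => norm_nonneg _) (Finset.mem_range.2 hn)
        have h2 := mul_nonneg hε.le (hS0 n ω)
        linarith
      · have h1 := hN n (by omega)
        have hp := hSpos n ω (by omega)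
        have h2 : dist ((birkSum I n ω)⁻¹ • birkSum J n ω) α ≤ ε := by
          have := dist_triangle ((birkSum I n ω)⁻¹ • birkSum J n ω) (x k) α
          linarith
        have h3 : birkSum g n ω
            = birkSum I n ω • ((birkSum I n ω)⁻¹ • birkSum J n ω - α) := by
          rw [hg, smul_sub, smul_inv_smul₀ hp.ne']
        have h4 : 0 ≤ ∑ n ∈ Finset.range (N + 1), ‖birkSum g n ω‖ :=
          Finset.sum_nonneg fun i _ => norm_nonneg _
        rw [h3, norm_smul, Real.norm_of_nonneg hp.le, ← dist_eq_norm]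
        have := mul_le_mul_of_nonneg_left h2 hp.le
        linarith)
    refine ⟨τ, ?_⟩
    rw [Metric.tendsto_nhds]
    intro ε hε
    filter_upwards [hτ (ε / 2) (by positivity), eventually_gt_atTop 0] with n h1 hn
    have hp := hSpos n τ hn
    have h3 : (birkSum I n τ)⁻¹ • birkSum J n τ - α = (birkSum I n τ)⁻¹ • birkSum g n τ := by
      rw [hg, smul_sub, inv_smul_smul₀ hp.ne']
    rw [dist_eq_norm, h3, norm_smul, Real.norm_of_nonneg (inv_nonneg.2 hp.le),
      inv_mul_lt_iff₀ hp]
    nlinarith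
  · rw [isBounded_iff_forall_norm_le]
    refine ⟨C / c, ?_⟩
    rintro α ⟨ω, hω⟩
    refine le_of_tendsto hω.norm ?_
    filter_upwards [eventually_gt_atTop 0] with n hn
    have hp := hSpos n ω hn
    have hC0 : 0 ≤ C := (norm_nonneg _).trans (hC ω)
    have h1 : ‖birkSum J n ω‖ ≤ n * C := by
      have := norm_sum_le_of_le (Finset.range n)
        (f := fun k => J (shiftMap^[k] ω)) (n := fun _ => C) (fun k _ => hC _)
      simpa [birkSum] using this
    rw [norm_smul, Real.norm_of_nonneg (inv_nonneg.2 hp.le), inv_mul_le_iff₀ hp,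
      ← mul_div_assoc, le_div_iff₀ hc]
    have h2 := mul_le_mul_of_nonneg_right h1 hc.le
    have h3 := mul_le_mul_of_nonneg_right (hSge n ω) hC0
    linarith
end

section
/- Let s ∈ (0,1), let I : E_A^∞ → ℝ be Hölder continuous with I(ω) ≥ −log s for all ω, and let J : E_A^∞ → ℝ^d be bounded and Hölder continuous. If E_A^∞ is nonempty and finitely irreducible, then K ⊆ closure(L), where K := {α ∈ ℝ^d : there exists ω ∈ E_A^∞ with lim_{n→∞} S_nJ(ω)/S_nI(ω) = α} and L := { (∫ I dμ)^{-1} ∫ J dμ : μ a σ-invariant Borel probability measure on E_A^∞ with ∫ I dμ < ∞ }. -/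
open MeasureTheory Filter Topology
open scoped ENNReal

theorem shift_iter_apply {E : Type*} {A : E → E → Bool} (ω : Subshift E A) (k i : ℕ) :
    (shiftMap^[k] ω).1 i = ω.1 (i + k) := by
  induction k generalizing ω with
  | zero => rfl
  | succ k ih =>
    rw [Function.iterate_succ_apply, ih]
    show ω.1 (i + k + 1) = _
    rfl

theorem closing {E : Type*} {A : E → E → Bool} (hfi : FinitelyIrreducible A) :
    ∃ (F : Set E) (M : ℕ), F.Finite ∧ ∀ n : ℕ, 1 ≤ n → ∀ ω : Subshift E A,
      ∃ (p : ℕ) (τ : Subshift E A), n ≤ p ∧ p ≤ n + M ∧ shiftMap^[p] τ = τ ∧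
        (∀ i < n, τ.1 i = ω.1 i) ∧ ∀ i, n ≤ i → i < p → τ.1 i ∈ F := by
  classical
  obtain ⟨W, hW⟩ := hfi
  refine ⟨{x | ∃ w ∈ W, x ∈ w}, W.sup List.length, ?_, ?_⟩
  · have : {x | ∃ w ∈ W, x ∈ w} = ⋃ w ∈ W, {x | x ∈ w} := by ext; simp
    rw [this]
    exact Set.Finite.biUnion W.finite_toSet (fun w _ => List.finite_toSet w)
  intro n hn ω
  obtain ⟨w, hw, hc⟩ := hW (ω.1 (n - 1)) (ω.1 0)
  set p := n + w.length with hp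
  let g : ℕ → E := fun r => if r < n then ω.1 r else (w ++ [ω.1 0]).getD (r - n) (ω.1 0)
  have hg1 : ∀ r < n, g r = ω.1 r := fun r hr => by simp [g, hr]
  have hgl : ∀ k (hk : k < (ω.1 (n - 1) :: (w ++ [ω.1 0])).length),
      (ω.1 (n - 1) :: (w ++ [ω.1 0]))[k] = g (n - 1 + k) := by
    intro k hk
    cases k with
    | zero => rw [hg1 _ (by omega)]; rfl
    | succ k =>
      have h1 : ¬ (n - 1 + (k + 1) < n) := by omega
      have h2 : n - 1 + (k + 1) - n = k := by omega
      have h3 : k < (w ++ [ω.1 0]).length := by simpa using hk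
      simp only [g, if_neg h1, h2, List.getElem_cons_succ]
      rw [List.getD_eq_getElem _ _ h3]
  have hgp : g p = g 0 := by
    rw [hg1 0 (by omega)]
    simp [g, hp]
  have hgA : ∀ r < p, A (g r) (g (r + 1)) = true := by
    intro r hr
    by_cases h : r + 1 < n
    · rw [hg1 r (by omega), hg1 _ h]; exact ω.2 r
    · have hk : (r - (n - 1)) + 1 < (ω.1 (n - 1) :: (w ++ [ω.1 0])).length := by
        simp; omega
      have := List.isChain_iff_getElem.1 hc (r - (n - 1)) hk
      rw [hgl, hgl] at this
      have e1 : n - 1 + (r - (n - 1)) = r := by omega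
      have e2 : n - 1 + (r - (n - 1) + 1) = r + 1 := by omega
      rwa [e1, e2] at this
  have hp0 : 0 < p := by omega
  refine ⟨p, ⟨fun i => g (i % p), ?_⟩, by omega, ?_, ?_, ?_, ?_⟩
  · intro i
    have h := hgA (i % p) (Nat.mod_lt _ hp0)
    have hlt := Nat.mod_lt i hp0
    by_cases h1 : i % p + 1 = p
    · have : (i + 1) % p = 0 := by rw [Nat.add_mod_eq_ite]; rcases Nat.lt_or_ge 1 p with h2 | h2
                                   · rw [Nat.mod_eq_of_lt h2, if_pos (by omega)]; omega
                                   · have : p = 1 := by omega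
                                     rw [this]; simp [Nat.mod_one]
      rw [h1, hgp] at h
      simpa only [this] using h
    · have : (i + 1) % p = i % p + 1 := by
        rw [Nat.add_mod, Nat.mod_eq_of_lt (a := 1) (by omega), Nat.mod_eq_of_lt (by omega)]
      simpa only [this] using h
  · have : w.length ≤ W.sup List.length := Finset.le_sup (f := List.length) hw
    omega
  · apply Subtype.ext
    funext i
    rw [shift_iter_apply]
    simp
  · intro i hi
    show g (i % p) = _
    rw [Nat.mod_eq_of_lt (by omega), hg1 i hi]
  · intro i hi hip
    show g (i % p) ∈ _
    rw [Nat.mod_eq_of_lt hip]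
    refine ⟨w, hw, ?_⟩
    have h3 : i - n < w.length := by omega
    simp only [g, if_neg (not_lt.2 hi)]
    rw [List.getD_eq_getElem _ _ (by simp; omega), List.getElem_append_left h3]
    exact List.getElem_mem h3

theorem holder_sum {E : Type*} {A : E → E → Bool} {X : Type*} [SeminormedAddCommGroup X]
    (f : Subshift E A → X) (a : ℝ) (ha : 0 < a) (hf : IsHolder f a) :
    ∃ C : ℝ, ∀ n : ℕ, ∀ ω τ : Subshift E A, (∀ i < n, τ.1 i = ω.1 i) →
      ‖birkSum f n τ - birkSum f n ω‖ ≤ C := by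
  obtain ⟨v, hv⟩ := hf
  have hs : Summable (fun j : ℕ => |v| * Real.exp (-a) ^ j) :=
    (summable_geometric_of_lt_one (Real.exp_pos _).le (by simpa using ha)).mul_left _
  refine ⟨∑' j : ℕ, |v| * Real.exp (-a) ^ j, fun n ω τ h => ?_⟩
  unfold birkSum
  rw [← Finset.sum_sub_distrib]
  calc _ ≤ ∑ k ∈ Finset.range n, ‖f (shiftMap^[k] τ) - f (shiftMap^[k] ω)‖ := norm_sum_le _ _
    _ ≤ ∑ k ∈ Finset.range n, |v| * Real.exp (-a) ^ (n - 1 - k) := by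
      apply Finset.sum_le_sum
      intro k hk
      have hk := Finset.mem_range.1 hk
      have := hv (n - k) (by omega) (shiftMap^[k] τ) (shiftMap^[k] ω) (fun i hi => by
        rw [shift_iter_apply, shift_iter_apply]; exact h _ (by omega))
      have e : a * (((n - k : ℕ) : ℝ) - 1) = a * ((n - 1 - k : ℕ) : ℝ) := by
        have : n - k = (n - 1 - k) + 1 := by omega
        rw [this]; push_cast; ring
      rw [e] at this
      rw [← Real.exp_nat_mul]
      have e2 : ((n - 1 - k : ℕ) : ℝ) * -a = -(a * ((n - 1 - k : ℕ) : ℝ)) := by ring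
      rw [e2, Real.exp_neg, ← div_eq_mul_inv, le_div_iff₀ (Real.exp_pos _)]
      exact this.trans (le_abs_self v)
    _ = ∑ j ∈ Finset.range n, |v| * Real.exp (-a) ^ j :=
      Finset.sum_range_reflect (fun j => |v| * Real.exp (-a) ^ j) n
    _ ≤ _ := hs.sum_le_tsum _ (fun _ _ => by positivity)

theorem holder_bdd {E : Type*} {A : E → E → Bool} {X : Type*} [SeminormedAddCommGroup X]
    (f : Subshift E A → X) (a : ℝ) (hf : IsHolder f a) (F : Set E) (hF : F.Finite) :
    ∃ C : ℝ, 0 ≤ C ∧ ∀ ω : Subshift E A, ω.1 0 ∈ F → ‖f ω‖ ≤ C := by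
  obtain ⟨v, hv⟩ := hf
  have h1 : ∀ e : E, ∃ c : ℝ, ∀ ω : Subshift E A, ω.1 0 = e → ‖f ω‖ ≤ c := by
    intro e
    by_cases h : ∃ τ : Subshift E A, τ.1 0 = e
    · obtain ⟨τ, hτ⟩ := h
      refine ⟨v + ‖f τ‖, fun ω hω => ?_⟩
      have := hv 1 le_rfl ω τ (fun i hi => by
        have : i = 0 := by omega
        rw [this, hω, hτ])
      simp at this
      have h2 := norm_sub_norm_le (f ω) (f τ)
      linarith
    · push Not at h
      exact ⟨0, fun ω hω => absurd hω (h ω)⟩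
  choose c hc using h1
  refine ⟨∑ e ∈ hF.toFinset, |c e|, Finset.sum_nonneg (fun _ _ => abs_nonneg _), fun ω hω => ?_⟩
  calc ‖f ω‖ ≤ c (ω.1 0) := hc _ ω rfl
    _ ≤ |c (ω.1 0)| := le_abs_self _
    _ ≤ _ := Finset.single_le_sum (f := fun e => |c e|) (fun _ _ => abs_nonneg _) (by simpa using hω)

theorem holder_close {E : Type*} {A : E → E → Bool} {X : Type*} [SeminormedAddCommGroup X]
    (f : Subshift E A → X) (a : ℝ) (ha : 0 < a) (hf : IsHolder f a) (F : Set E) (hF : F.Finite)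
    (M : ℕ) : ∃ C : ℝ, ∀ n p : ℕ, ∀ ω τ : Subshift E A, n ≤ p → p ≤ n + M →
      (∀ i < n, τ.1 i = ω.1 i) → (∀ i, n ≤ i → i < p → τ.1 i ∈ F) →
      ‖birkSum f p τ - birkSum f n ω‖ ≤ C := by
  obtain ⟨C1, h1⟩ := holder_sum f a ha hf
  obtain ⟨C2, h20, h2⟩ := holder_bdd f a hf F hF
  refine ⟨M * C2 + C1, fun n p ω τ hnp hpM hτ hF => ?_⟩
  have e : birkSum f p τ - birkSum f n ω =
      ∑ k ∈ Finset.Ico n p, f (shiftMap^[k] τ) + (birkSum f n τ - birkSum f n ω) := by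
    unfold birkSum
    rw [← Finset.sum_range_add_sum_Ico _ hnp]; abel
  rw [e]
  refine (norm_add_le _ _).trans (add_le_add ?_ (h1 n ω τ hτ))
  calc _ ≤ ∑ k ∈ Finset.Ico n p, ‖f (shiftMap^[k] τ)‖ := norm_sum_le _ _
    _ ≤ ∑ k ∈ Finset.Ico n p, C2 := by
      apply Finset.sum_le_sum
      intro k hk
      rw [Finset.mem_Ico] at hk
      apply h2
      rw [shift_iter_apply, zero_add]
      exact hF k hk.1 hk.2
    _ = ((p - n : ℕ) : ℝ) * C2 := by simp
    _ ≤ _ := by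
      apply mul_le_mul_of_nonneg_right _ h20
      exact_mod_cast (by omega : p - n ≤ M)

theorem measurable_shiftMap {E : Type*} [MeasurableSpace E] {A : E → E → Bool} :
    Measurable (shiftMap : Subshift E A → Subshift E A) := by
  apply Measurable.subtype_mk
  exact measurable_pi_lambda _ (fun i => (measurable_pi_apply (i + 1)).comp measurable_subtype_coe)

theorem periodic_measure {E : Type*} [Countable E] [MeasurableSpace E]
    [MeasurableSingletonClass E] {A : E → E → Bool} {d : ℕ}
    (I : Subshift E A → ℝ) (J : Subshift E A → EuclideanSpace ℝ (Fin d))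
    (p : ℕ) (hp : 0 < p) (τ : Subshift E A) (hτ : shiftMap^[p] τ = τ) :
    ∃ μ : Measure (Subshift E A),
        IsProbabilityMeasure μ ∧ MeasurePreserving shiftMap μ μ ∧ Integrable I μ ∧
        (birkSum I p τ)⁻¹ • birkSum J p τ = (∫ ω, I ω ∂μ)⁻¹ • ∫ ω, J ω ∂μ := by
  have hp0 : (p : ℝ≥0∞) ≠ 0 := by exact_mod_cast hp.ne'
  have hpt : (p : ℝ≥0∞) ≠ ⊤ := ENNReal.natCast_ne_top p
  have hint : ∀ {X : Type} [NormedAddCommGroup X] [NormedSpace ℝ X] (f : Subshift E A → X),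
      ∀ k ∈ Finset.range p, Integrable f (Measure.dirac (shiftMap^[k] τ)) := by
    intro X _ _ f k _
    exact integrable_dirac (by simp)
  have hval : ∀ {X : Type} [NormedAddCommGroup X] [NormedSpace ℝ X] [CompleteSpace X]
      (f : Subshift E A → X),
      ∫ ω, f ω ∂((p : ℝ≥0∞)⁻¹ • ∑ k ∈ Finset.range p, Measure.dirac (shiftMap^[k] τ)) =
        (p : ℝ)⁻¹ • birkSum f p τ := by
    intro X _ _ _ f
    rw [integral_smul_measure, integral_finset_sum_measure (hint f)]
    simp [birkSum]
  refine ⟨(p : ℝ≥0∞)⁻¹ • ∑ k ∈ Finset.range p, Measure.dirac (shiftMap^[k] τ), ⟨?_⟩,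
    ⟨measurable_shiftMap, ?_⟩, ?_, ?_⟩
  · simp [ENNReal.inv_mul_cancel hp0 hpt]
  · rw [Measure.map_smul, ← Measure.mapₗ_apply_of_measurable measurable_shiftMap, map_sum]
    congr 1
    simp only [Measure.mapₗ_apply_of_measurable measurable_shiftMap,
      Measure.map_dirac' measurable_shiftMap, ← Function.iterate_succ_apply' shiftMap]
    have h := Finset.sum_range_succ (fun k => Measure.dirac (shiftMap^[k] τ)) p
    rw [Finset.sum_range_succ', hτ] at h
    ext s hs
    have h' := congrArg (fun m : Measure (Subshift E A) => m s) h
    simp only [Measure.add_apply, Function.iterate_zero, id] at h'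
    exact (ENNReal.add_left_inj (measure_ne_top _ _)).1 h'
  · exact Integrable.smul_measure (integrable_finset_sum_measure.2 (hint I)) (by simpa using hp.ne')
  · rw [hval, hval, smul_eq_mul, smul_smul, mul_inv, inv_inv]
    congr 1
    have : (p : ℝ) ≠ 0 := by exact_mod_cast hp.ne'
    field_simp

/-- `K ⊆ closure L`, where `L` is the set of ratios
`(∫ I dμ)⁻¹ ∫ J dμ` over shift-invariant Borel probability measures with `∫ I dμ < ∞`. -/
theorem K_subset_closure_L {E : Type*} [Countable E] [MeasurableSpace E]
    [MeasurableSingletonClass E] (A : E → E → Bool) (d : ℕ)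
    (hne : Nonempty (Subshift E A)) (hfi : FinitelyIrreducible A)
    (s : ℝ) (hs : s ∈ Set.Ioo (0 : ℝ) 1)
    (I : Subshift E A → ℝ) (aI : ℝ) (haI : 0 < aI) (hIhold : IsHolder I aI)
    (hIlb : ∀ ω, -Real.log s ≤ I ω)
    (J : Subshift E A → EuclideanSpace ℝ (Fin d)) (aJ : ℝ) (haJ : 0 < aJ)
    (hJhold : IsHolder J aJ) (hJbdd : ∃ C : ℝ, ∀ ω, ‖J ω‖ ≤ C) :
    {α : EuclideanSpace ℝ (Fin d) | ∃ ω : Subshift E A,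
        Tendsto (fun n => (birkSum I n ω)⁻¹ • birkSum J n ω) atTop (𝓝 α)} ⊆
      closure {x : EuclideanSpace ℝ (Fin d) | ∃ μ : Measure (Subshift E A),
        IsProbabilityMeasure μ ∧ MeasurePreserving shiftMap μ μ ∧ Integrable I μ ∧
        x = (∫ ω, I ω ∂μ)⁻¹ • ∫ ω, J ω ∂μ} := by
  rintro α ⟨ω, hα⟩
  obtain ⟨F, M, hF, hcl⟩ := closing hfi
  obtain ⟨CI, hCI⟩ := holder_close I aI haI hIhold F hF M
  obtain ⟨CJ, hCJ⟩ := holder_close J aJ haJ hJhold F hF M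
  have hcl' : ∀ n : ℕ, ∃ (p : ℕ) (τ : Subshift E A), 0 < p ∧ shiftMap^[p] τ = τ ∧
      ‖birkSum I p τ - birkSum I (n + 1) ω‖ ≤ CI ∧
      ‖birkSum J p τ - birkSum J (n + 1) ω‖ ≤ CJ := by
    intro n
    obtain ⟨p, τ, h1, h2, h3, h4, h5⟩ := hcl (n + 1) (by omega) ω
    exact ⟨p, τ, by omega, h3, hCI _ _ _ _ h1 h2 h4 h5, hCJ _ _ _ _ h1 h2 h4 h5⟩
  choose p τ hp hper hI hJ using hcl'
  have hlog : 0 < -Real.log s := by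
    have := Real.log_neg hs.1 hs.2
    linarith
  have ha : Tendsto (fun n => birkSum I (n + 1) ω) atTop atTop := by
    have h1 : Tendsto (fun n : ℕ => ((n + 1 : ℕ) : ℝ) * (-Real.log s)) atTop atTop :=
      (tendsto_natCast_atTop_atTop.comp (tendsto_add_atTop_nat 1)).atTop_mul_const hlog
    refine tendsto_atTop_mono (fun n => ?_) h1
    have := Finset.card_nsmul_le_sum (Finset.range (n + 1)) (fun k => I (shiftMap^[k] ω))
      (-Real.log s) (fun k _ => hIlb _)
    simpa [birkSum] using this
  have hinv := ha.inv_tendsto_atTop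
  have hb := (tendsto_add_atTop_iff_nat 1).2 hα
  refine mem_closure_of_tendsto (f := fun n => (birkSum I (p n) (τ n))⁻¹ • birkSum J (p n) (τ n))
    (b := atTop) ?_ (Eventually.of_forall fun n => periodic_measure I J (p n) (hp n) (τ n) (hper n))
  -- normalised numerators and denominators
  have hden : Tendsto (fun n => (birkSum I (n + 1) ω)⁻¹ * birkSum I (p n) (τ n)) atTop (𝓝 1) := by
    have h0 : Tendsto (fun n => (birkSum I (n + 1) ω)⁻¹ *
        (birkSum I (p n) (τ n) - birkSum I (n + 1) ω)) atTop (𝓝 0) := by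
      refine squeeze_zero_norm (a := fun n => ‖(birkSum I (n + 1) ω)⁻¹‖ * CI) (fun n => ?_) ?_
      · rw [norm_mul]; exact mul_le_mul_of_nonneg_left (hI n) (norm_nonneg _)
      · simpa using hinv.norm.mul_const CI
    have h1 := h0.add_const 1
    rw [zero_add] at h1
    refine h1.congr' ?_
    filter_upwards [ha.eventually_gt_atTop 0] with n hn
    field_simp
    ring
  have hnum : Tendsto (fun n => (birkSum I (n + 1) ω)⁻¹ • birkSum J (p n) (τ n)) atTop (𝓝 α) := by
    have h0 : Tendsto (fun n => (birkSum I (n + 1) ω)⁻¹ •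
        (birkSum J (p n) (τ n) - birkSum J (n + 1) ω)) atTop (𝓝 0) := by
      refine squeeze_zero_norm (a := fun n => ‖(birkSum I (n + 1) ω)⁻¹‖ * CJ) (fun n => ?_) ?_
      · rw [norm_smul]; exact mul_le_mul_of_nonneg_left (hJ n) (norm_nonneg _)
      · simpa using hinv.norm.mul_const CJ
    have h1 := h0.add hb
    rw [zero_add] at h1
    refine h1.congr (fun n => ?_)
    rw [← smul_add, sub_add_cancel]
  have h := (hden.inv₀ one_ne_zero).smul hnum
  rw [inv_one, one_smul] at h
  refine h.congr' ?_
  filter_upwards [ha.eventually_gt_atTop 0] with n hn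
  rw [smul_smul]
  congr 1
  rw [mul_inv, inv_inv]
  field_simp
end

section
/- Suppose the alphabet E is finite and E_A^∞ is nonempty. Let I : E_A^∞ → ℝ be continuous with I(ω) > 0 for all ω, and let J : E_A^∞ → ℝ^d be continuous. If ω ∈ E_A^∞ and α ∈ ℝ^d satisfy lim_{n→∞} S_nJ(ω)/S_nI(ω) = α, then there exists a σ-invariant Borel probability measure μ on E_A^∞ with α = (∫ I dμ)^{-1} ∫ J dμ; in other words, in the finite alphabet case K ⊆ L. -/
open MeasureTheory Filter Topology
open scoped ENNReal

/-- in the finite alphabet case, every value `α` attained as a limit of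
Birkhoff ratios comes from an invariant Borel probability measure, i.e. `K ⊆ L`. -/
theorem K_subset_L_finite_alphabet {E : Type*} [Finite E] [TopologicalSpace E]
    [DiscreteTopology E] [MeasurableSpace E] [BorelSpace E]
    (A : E → E → Bool) (d : ℕ) (hne : Nonempty (Subshift E A))
    (I : Subshift E A → ℝ) (hIcont : Continuous I) (hIpos : ∀ ω, 0 < I ω)
    (J : Subshift E A → EuclideanSpace ℝ (Fin d)) (hJcont : Continuous J)
    (ω : Subshift E A) (α : EuclideanSpace ℝ (Fin d))
    (hlim : Tendsto (fun n => (birkSum I n ω)⁻¹ • birkSum J n ω) atTop (𝓝 α)) :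
    ∃ μ : Measure (Subshift E A), IsProbabilityMeasure μ ∧
      MeasurePreserving shiftMap μ μ ∧
      α = (∫ x, I x ∂μ)⁻¹ • ∫ x, J x ∂μ := by
  have hcl : IsClosed {ω : ℕ → E | ∀ i : ℕ, A (ω i) (ω (i + 1)) = true} := by
    rw [Set.ofPred_forall]
    refine isClosed_iInter fun i => ?_
    have h2 : Continuous fun ω : ℕ → E => (ω i, ω (i + 1)) :=
      (continuous_apply i).prodMk (continuous_apply (i + 1))
    have h1 : Continuous fun p : E × E => A p.1 p.2 := continuous_of_discreteTopology
    have : Continuous fun ω : ℕ → E => A (ω i) (ω (i + 1)) := h1.comp h2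
    exact isClosed_eq this continuous_const
  have : CompactSpace (Subshift E A) := isCompact_iff_compactSpace.mp hcl.isCompact
  have : SecondCountableTopology E := inferInstance
  have : BorelSpace (Subshift E A) := inferInstance
  have hσ : Continuous (shiftMap : Subshift E A → Subshift E A) := by
    have h : Continuous fun x : Subshift E A => fun i : ℕ => x.1 (i + 1) :=
      continuous_pi fun i => (continuous_apply (i + 1)).comp continuous_subtype_val
    exact h.subtype_mk fun x i => x.2 (i + 1)
  let m : ℕ → Measure (Subshift E A) := fun n =>
    ((n : ENNReal) + 1)⁻¹ • ∑ k ∈ Finset.range (n + 1), Measure.dirac (shiftMap^[k] ω)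
  have hm : ∀ n, IsProbabilityMeasure (m n) := fun n => ⟨by
    simp only [m, Measure.smul_apply, Measure.finsetSum_apply, measure_univ, smul_eq_mul]
    simp only [Finset.sum_const, Finset.card_range, nsmul_eq_mul, mul_one]
    push_cast
    exact ENNReal.inv_mul_cancel (by simp) (by simp)⟩
  have hint : ∀ (f : Subshift E A → ℝ) n, Continuous f →
      ∫ x, f x ∂(m n) = ((n : ℝ) + 1)⁻¹ * birkSum f (n + 1) ω := by
    intro f n hf
    simp only [m]
    rw [integral_smul_measure, integral_finsetSum_measure]
    · simp [birkSum, integral_dirac]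
      left
      rw [ENNReal.toReal_add (by simp) (by simp)]
      simp
    · intro i _
      exact hf.integrable_of_hasCompactSupport (HasCompactSupport.of_compactSpace f)
  let U : Ultrafilter ℕ := hyperfilter ℕ
  have hU : (U : Filter ℕ) ≤ atTop := by
    rw [← Nat.cofinite_eq_atTop]; exact hyperfilter_le_cofinite
  let P : ℕ → ProbabilityMeasure (Subshift E A) := fun n => ⟨m n, hm n⟩
  obtain ⟨μ, -, hμ⟩ := isCompact_univ.ultrafilter_le_nhds (U.map P) (by simp)
  have hT : Tendsto P U (𝓝 μ) := hμ
  rw [ProbabilityMeasure.tendsto_iff_forall_integral_tendsto] at hT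
  have key : ∀ f : Subshift E A → ℝ, Continuous f →
      Tendsto (fun n : ℕ => ((n : ℝ) + 1)⁻¹ * birkSum f (n + 1) ω) U (𝓝 (∫ x, f x ∂μ)) := by
    intro f hf
    have := hT (BoundedContinuousFunction.mkOfCompact ⟨f, hf⟩)
    refine this.congr fun n => ?_
    exact hint f n hf
  have hintg : ∀ f : Subshift E A → ℝ, Continuous f → Integrable f (μ : Measure _) := fun f hf =>
    hf.integrable_of_hasCompactSupport (HasCompactSupport.of_compactSpace f)
  refine ⟨μ, inferInstance, ⟨hσ.measurable, ?_⟩, ?_⟩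
  · have := Measure.isProbabilityMeasure_map (μ := (μ : Measure (Subshift E A)))
      hσ.measurable.aemeasurable
    have : HasOuterApproxClosed (Subshift E A) := by
      have : SecondCountableTopology (Subshift E A) :=
        IsInducing.subtypeVal.secondCountableTopology
      have : TopologicalSpace.MetrizableSpace (Subshift E A) :=
        TopologicalSpace.metrizableSpace_of_t3_secondCountable _
      let _ := TopologicalSpace.metrizableSpaceMetric (Subshift E A)
      infer_instance
    refine ext_of_forall_integral_eq_of_IsFiniteMeasure fun f => ?_
    rw [integral_map hσ.measurable.aemeasurable f.continuous.aestronglyMeasurable]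
    have h1 := key _ (f.continuous.comp hσ)
    have h2 := key _ f.continuous
    have h3 : Tendsto (fun n : ℕ => ((n : ℝ) + 1)⁻¹ * (f (shiftMap^[n + 1] ω) - f ω)) U (𝓝 0) := by
      refine Tendsto.mono_left ?_ hU
      have h0 : Tendsto (fun n : ℕ => ((n : ℝ) + 1)⁻¹) atTop (𝓝 0) := by
        simpa using tendsto_one_div_add_atTop_nhds_zero_nat (𝕜 := ℝ)
      refine bdd_le_mul_tendsto_zero' (2 * ‖f‖) (Eventually.of_forall fun n => ?_) h0 |>.congr
        fun n => mul_comm _ _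
      rw [← Real.norm_eq_abs]
      exact (norm_sub_le _ _).trans (by linarith [f.norm_coe_le_norm (shiftMap^[n + 1] ω), f.norm_coe_le_norm ω])
    have h4 := h2.add h3
    rw [add_zero] at h4
    refine tendsto_nhds_unique h1 (h4.congr fun n => ?_)
    rw [← mul_add]
    congr 1
    have e1 := Finset.sum_range_succ (fun k => f (shiftMap^[k] ω)) (n + 1)
    have e2 := Finset.sum_range_succ' (fun k => f (shiftMap^[k] ω)) (n + 1)
    simp only [birkSum, Function.comp_apply, ← Function.iterate_succ_apply']
    simp only [Function.iterate_zero, id_eq] at e2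
    linarith
  · have hIp : 0 < ∫ x, I x ∂(μ : Measure (Subshift E A)) := by
      rw [integral_pos_iff_support_of_nonneg (fun x => (hIpos x).le) (hintg I hIcont)]
      have : Function.support I = Set.univ := by
        ext x; simp [(hIpos x).ne']
      rw [this]; simp
    have hJi : Integrable J (μ : Measure (Subshift E A)) :=
      hJcont.integrable_of_hasCompactSupport (HasCompactSupport.of_compactSpace J)
    rw [eq_inv_smul_iff₀ hIp.ne']
    ext i
    have e : (∫ x, J x ∂(μ : Measure (Subshift E A))) i = ∫ x, J x i ∂(μ : Measure (Subshift E A)) :=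
      ((EuclideanSpace.proj (𝕜 := ℝ) i).integral_comp_comm hJi).symm
    have hc : Continuous fun x => J x i := (EuclideanSpace.proj (𝕜 := ℝ) i).continuous.comp hJcont
    rw [e]
    have h1 := key _ hc
    have h2 := key _ hIcont
    have h3 : Tendsto (fun n => ((birkSum I (n+1) ω)⁻¹ • birkSum J (n+1) ω) i) U (𝓝 (α i)) :=
      (((EuclideanSpace.proj (𝕜 := ℝ) i).continuous.tendsto α).comp
        (hlim.comp (tendsto_add_atTop_nat 1))).mono_left hU
    refine tendsto_nhds_unique (h2.mul h3) (h1.congr fun n => ?_)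
    have hp : 0 < birkSum I (n + 1) ω :=
      Finset.sum_pos (fun k _ => hIpos _) (by simp)
    have eS : (birkSum J (n+1) ω) i = birkSum (fun x => J x i) (n+1) ω :=
      map_sum (EuclideanSpace.proj (𝕜 := ℝ) i) _ _
    rw [PiLp.smul_apply, eS, smul_eq_mul]
    field_simp
end

section
/- Let I : ℕ^ℕ → ℝ be Borel measurable with I(ω) ≥ c for all ω and some constant c > 0, and suppose sup_k inf{ I(ω) : ω_1 = k } = ∞. Then there exists a σ-invariant ergodic Borel probability measure μ on ℕ^ℕ (a Bernoulli product measure) with ∫ I dμ = ∞ such that for every bounded Borel measurable J : ℕ^ℕ → ℝ^d and μ-almost every ω, lim_{n→∞} S_nJ(ω)/S_nI(ω) = 0. In particular there exists ω ∈ ℕ^ℕ with S_nJ(ω)/S_nI(ω) → 0, i.e. 0 belongs to the level-value set K. -/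
open MeasureTheory Filter Topology
open scoped ENNReal

/-- The left shift on the full shift space `ℕ^ℕ`. -/
def fullShift (ω : ℕ → ℕ) : ℕ → ℕ := fun i => ω (i + 1)

/-- The `n`-th Birkhoff sum `S_n f = ∑_{k=0}^{n-1} f ∘ σ^k` on the full shift. -/
noncomputable def birkSumF {X : Type*} [AddCommMonoid X]
    (f : (ℕ → ℕ) → X) (n : ℕ) (ω : ℕ → ℕ) : X :=
  ∑ k ∈ Finset.range n, f (fullShift^[k] ω)

theorem fullShift_iterate (n : ℕ) (ω : ℕ → ℕ) (i : ℕ) : (fullShift^[n] ω) i = ω (i + n) := by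
  induction n generalizing ω with
  | zero => rfl
  | succ n ih =>
    rw [Function.iterate_succ_apply, ih]
    show ω (i + n + 1) = _
    rw [add_assoc]

theorem measurable_fullShift : Measurable fullShift :=
  measurable_pi_iff.2 fun i => measurable_pi_apply (i + 1)

theorem ergodic_fullShift (ν : Measure ℕ) [IsProbabilityMeasure ν] :
    Ergodic fullShift (Measure.infinitePi (fun _ : ℕ => ν)) := by
  refine ⟨⟨measurable_fullShift, ?_⟩, ⟨?_⟩⟩
  · exact Measure.map_infinitePi_infinitePi_of_inj (P := fun _ : ℕ => ν)
      (f := fun i : ℕ => i + 1) (add_left_injective 1)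
  · intro s hs hinv
    have hind := ProbabilityTheory.iIndepFun_infinitePi (P := fun _ : ℕ => ν)
      (X := fun _ x => x) (fun _ => measurable_id)
    have h01 : Measure.infinitePi (fun _ : ℕ => ν) s = 0 ∨
        Measure.infinitePi (fun _ : ℕ => ν) s = 1 := by
      refine ProbabilityTheory.measure_zero_or_one_of_measurableSet_limsup_atTop
        (fun n => (measurable_pi_apply n).comap_le) hind ?_
      rw [limsup_eq_iInf_iSup_of_nat, MeasurableSpace.measurableSet_iInf]
      intro n
      have hn : (fullShift^[n]) ⁻¹' s = s := by
        induction n with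
        | zero => rfl
        | succ n ih => rw [Function.iterate_succ, Set.preimage_comp, ih, hinv]
      rw [← hn]
      suffices hmeas : Measurable[⨆ i, ⨆ (_ : i ≥ n), MeasurableSpace.comap
          (fun ω : ℕ → ℕ => ω i) inferInstance, MeasurableSpace.pi] (fullShift^[n]) from hmeas hs
      refine @measurable_pi_lambda _ _ _ (_) _ _ fun i => ?_
      have : (fun ω : ℕ → ℕ => (fullShift^[n] ω) i) = fun ω => ω (i + n) := by
        funext ω; exact fullShift_iterate n ω i
      rw [this]
      refine Measurable.mono (comap_measurable (fun ω : ℕ → ℕ => ω (i + n))) ?_ le_rfl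
      exact le_iSup₂_of_le (f := fun (i : ℕ) (_ : i ≥ n) =>
        MeasurableSpace.comap (fun ω : ℕ → ℕ => ω i) inferInstance) (i + n)
        (Nat.le_add_left n i) le_rfl
    rw [eventuallyConst_set']
    rcases h01 with h | h
    · left
      exact ae_eq_empty.2 h
    · right
      rw [ae_eq_univ]
      exact (prob_compl_eq_zero_iff hs).2 h

theorem slln_count (ν : Measure ℕ) [IsProbabilityMeasure ν] (X : ℕ → ℝ) (C : ℝ)
    (hX : ∀ m, ‖X m‖ ≤ C) :
    ∀ᵐ ω ∂(Measure.infinitePi (fun _ : ℕ => ν)),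
      Tendsto (fun n : ℕ => (∑ i ∈ Finset.range n, X (ω i)) / n) atTop (𝓝 (∫ m, X m ∂ν)) := by
  have hXm : Measurable X := measurable_from_top
  have h := ProbabilityTheory.strong_law_ae_real (μ := Measure.infinitePi (fun _ : ℕ => ν))
    (fun i ω => X (ω i)) ?_ ?_ ?_
  · have e : ∫ ω : ℕ → ℕ, X (ω 0) ∂(Measure.infinitePi (fun _ : ℕ => ν)) = ∫ m, X m ∂ν := by
      conv_rhs => rw [← Measure.infinitePi_map_eval (fun _ : ℕ => ν) 0]
      rw [integral_map]
      · exact (measurable_pi_apply 0).aemeasurable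
      · exact hXm.aestronglyMeasurable
    rw [← e]
    exact h
  · exact Integrable.of_bound (by fun_prop : Measurable _).aestronglyMeasurable C
      (ae_of_all _ fun ω => hX _)
  · intro i j hij
    exact (ProbabilityTheory.iIndepFun_infinitePi (P := fun _ : ℕ => ν)
      (X := fun _ => X) (fun _ => hXm)).indepFun hij
  · intro i
    have h0 : ProbabilityTheory.IdentDistrib (fun ω : ℕ → ℕ => ω i) (fun ω : ℕ → ℕ => ω 0)
        (Measure.infinitePi (fun _ : ℕ => ν)) (Measure.infinitePi (fun _ : ℕ => ν)) :=
      ⟨(measurable_pi_apply i).aemeasurable, (measurable_pi_apply 0).aemeasurable, by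
        rw [Measure.infinitePi_map_eval, Measure.infinitePi_map_eval]⟩
    exact h0.comp hXm

theorem exists_base (k : ℕ → ℕ) : ∃ ν : Measure ℕ, IsProbabilityMeasure ν ∧
    ∀ j, (2⁻¹ : ℝ≥0∞) ^ (j + 1) ≤ ν {k j} := by
  refine ⟨Measure.sum (fun j => (2⁻¹ : ℝ≥0∞) ^ (j + 1) • Measure.dirac (k j)), ⟨?_⟩, fun j => ?_⟩
  · rw [Measure.sum_apply _ MeasurableSet.univ]
    simp only [Measure.smul_apply, measure_univ, smul_eq_mul, mul_one]
    simp_rw [pow_succ]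
    rw [ENNReal.tsum_mul_right, ENNReal.tsum_geometric, ENNReal.one_sub_inv_two, inv_inv]
    exact ENNReal.mul_inv_cancel (by simp) (by simp)
  · refine le_trans ?_ (Measure.le_sum_apply _ _)
    refine le_trans ?_ (ENNReal.le_tsum j)
    simp

/-- if `I ≥ c > 0` and `sup_k inf {I ω : ω₁ = k} = ∞`, then there is a
shift-invariant ergodic Bernoulli product measure `μ` with `∫ I dμ = ∞` such that for every
bounded Borel `J : ℕ^ℕ → ℝ^d` and `μ`-a.e. `ω` one has `S_nJ(ω)/S_nI(ω) → 0`; in particular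
some `ω` realizes the limit `0`, i.e. `0 ∈ K`. -/
theorem zero_in_K (I : (ℕ → ℕ) → ℝ) (hImeas : Measurable I)
    (c : ℝ) (hc : 0 < c) (hIc : ∀ ω, c ≤ I ω)
    (hsup : ∀ C : ℝ, ∃ k : ℕ, ∀ ω : ℕ → ℕ, ω 0 = k → C ≤ I ω) :
    ∃ μ : Measure (ℕ → ℕ), IsProbabilityMeasure μ ∧ Ergodic fullShift μ ∧
      (∃ p : ℕ → ℝ≥0∞, (∑' i, p i) = 1 ∧ ∀ (n : ℕ) (w : Fin n → ℕ),
        μ {ω : ℕ → ℕ | ∀ i : Fin n, ω i = w i} = ∏ i : Fin n, p (w i)) ∧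
      (∫⁻ ω, ENNReal.ofReal (I ω) ∂μ = ⊤) ∧
      ∀ (d : ℕ) (J : (ℕ → ℕ) → EuclideanSpace ℝ (Fin d)), Measurable J →
        (∃ C : ℝ, ∀ ω, ‖J ω‖ ≤ C) →
        (∀ᵐ ω ∂μ, Tendsto (fun n => (birkSumF I n ω)⁻¹ • birkSumF J n ω) atTop (𝓝 0)) ∧
        ∃ ω : ℕ → ℕ, Tendsto (fun n => (birkSumF I n ω)⁻¹ • birkSumF J n ω) atTop (𝓝 0) := by
  choose k hk using fun j : ℕ => hsup (4 ^ j)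
  obtain ⟨ν, hν, hνk⟩ := exists_base k
  have hexp : ∀ B : ℝ, ∃ j : ℕ, B < 2 ^ j / 2 := by
    intro B
    obtain ⟨j, hj⟩ := pow_unbounded_of_one_lt (2 * B) (one_lt_two : (1 : ℝ) < 2)
    exact ⟨j, by linarith⟩
  have hae : ∀ᵐ ω ∂(Measure.infinitePi (fun _ : ℕ => ν)), ∀ B : ℝ,
      ∀ᶠ n : ℕ in atTop, B * n < birkSumF I n ω := by
    have h1 : ∀ᵐ ω ∂(Measure.infinitePi (fun _ : ℕ => ν)), ∀ j : ℕ,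
        Tendsto (fun n : ℕ => (∑ i ∈ Finset.range n,
          ({k j} : Set ℕ).indicator (fun _ => (4 : ℝ) ^ j) (ω i)) / n) atTop
          (𝓝 (∫ m, ({k j} : Set ℕ).indicator (fun _ => (4 : ℝ) ^ j) m ∂ν)) := by
      rw [ae_all_iff]
      intro j
      refine slln_count ν _ (4 ^ j) fun m => ?_
      refine (norm_indicator_le_norm_self _ _).trans ?_
      simp
    filter_upwards [h1] with ω hω B
    obtain ⟨j, hj⟩ := hexp B
    have hint : (2 : ℝ) ^ j / 2 ≤ ∫ m, ({k j} : Set ℕ).indicator (fun _ => (4 : ℝ) ^ j) m ∂ν := by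
      rw [integral_indicator_const _ (measurableSet_singleton _), smul_eq_mul]
      have h2 : ((2 : ℝ)⁻¹) ^ (j + 1) ≤ ν.real {k j} := by
        have := ENNReal.toReal_mono (measure_ne_top ν _) (hνk j)
        simpa [Measure.real] using this
      calc (2 : ℝ) ^ j / 2 = (2⁻¹) ^ (j + 1) * 4 ^ j := by
            rw [show (4 : ℝ) = 2 * 2 by norm_num, mul_pow, pow_succ, inv_pow]
            field_simp
        _ ≤ _ := by gcongr
    filter_upwards [(hω j).eventually_const_lt (hj.trans_le hint), eventually_gt_atTop 0]
      with n hn hn0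
    have hn0' : (0 : ℝ) < n := by exact_mod_cast hn0
    rw [lt_div_iff₀ hn0'] at hn
    refine hn.trans_le ?_
    unfold birkSumF
    refine Finset.sum_le_sum fun i _ => ?_
    have h3 : (fullShift^[i] ω) 0 = ω i := by rw [fullShift_iterate, zero_add]
    by_cases h4 : ω i = k j
    · rw [Set.indicator_of_mem (by simpa using h4)]
      exact hk j _ (h3.trans h4)
    · rw [Set.indicator_of_notMem (by simpa using h4)]
      exact hc.le.trans (hIc _)
  refine ⟨Measure.infinitePi (fun _ : ℕ => ν), inferInstance, ergodic_fullShift ν,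
    ⟨fun i => ν {i}, ?_, ?_⟩, ?_, ?_⟩
  · have := measure_univ (μ := ν)
    rw [← this, ← Set.iUnion_of_singleton ℕ, measure_iUnion]
    · intro i j hij
      simpa using hij
    · intro i; exact measurableSet_singleton i
  · intro n w
    have he : {ω : ℕ → ℕ | ∀ i : Fin n, ω i = w i} =
        Set.pi (Finset.range n : Finset ℕ)
          (fun i => if h : i < n then {w ⟨i, h⟩} else Set.univ) := by
      ext ω
      simp only [Set.mem_ofPred_eq, Set.mem_pi, Finset.coe_range, Set.mem_Iio]
      constructor
      · intro h i hi
        rw [dif_pos hi]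
        exact h ⟨i, hi⟩
      · intro h i
        have := h i i.2
        rw [dif_pos i.2] at this
        exact this
    rw [he, Measure.infinitePi_pi]
    · rw [Finset.prod_range]
      refine Finset.prod_congr rfl fun i _ => ?_
      rw [dif_pos i.2]
    · intro i _
      exact MeasurableSet.of_discrete
  · refine ENNReal.eq_top_of_forall_nnreal_le fun r => ?_
    obtain ⟨j, hj⟩ := hexp r
    have hm : Measure.infinitePi (fun _ : ℕ => ν) {ω : ℕ → ℕ | ω 0 = k j} = ν {k j} := by
      conv_rhs => rw [← Measure.infinitePi_map_eval (fun _ : ℕ => ν) 0]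
      rw [Measure.map_apply (measurable_pi_apply 0) (measurableSet_singleton _)]
      rfl
    calc (r : ℝ≥0∞) ≤ ENNReal.ofReal (4 ^ j * (2⁻¹) ^ (j + 1)) := by
          rw [← ENNReal.ofReal_coe_nnreal]
          apply ENNReal.ofReal_le_ofReal
          refine hj.le.trans (le_of_eq ?_)
          rw [show (4 : ℝ) = 2 * 2 by norm_num, mul_pow, pow_succ, inv_pow]
          field_simp
      _ = ENNReal.ofReal (4 ^ j) * (2⁻¹) ^ (j + 1) := by
          rw [ENNReal.ofReal_mul (by positivity), ENNReal.ofReal_pow (p := (2 : ℝ)⁻¹) (by norm_num),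
            ENNReal.ofReal_inv_of_pos (by norm_num)]
          simp
      _ ≤ ENNReal.ofReal (4 ^ j) * ν {k j} := by gcongr; exact hνk j
      _ = ∫⁻ ω in {ω : ℕ → ℕ | ω 0 = k j}, ENNReal.ofReal (4 ^ j)
            ∂(Measure.infinitePi (fun _ : ℕ => ν)) := by
          rw [setLIntegral_const, hm]
      _ ≤ ∫⁻ ω in {ω : ℕ → ℕ | ω 0 = k j}, ENNReal.ofReal (I ω)
            ∂(Measure.infinitePi (fun _ : ℕ => ν)) :=
          setLIntegral_mono hImeas.ennreal_ofReal fun ω hω =>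
            ENNReal.ofReal_le_ofReal (hk j ω hω)
      _ ≤ _ := setLIntegral_le_lintegral _ _
  · intro d J _ ⟨C, hC⟩
    have key : ∀ᵐ ω ∂(Measure.infinitePi (fun _ : ℕ => ν)),
        Tendsto (fun n => (birkSumF I n ω)⁻¹ • birkSumF J n ω) atTop (𝓝 0) := by
      filter_upwards [hae] with ω hω
      have hC0 : 0 ≤ C := (norm_nonneg _).trans (hC ω)
      rw [Metric.tendsto_nhds]
      intro ε hε
      filter_upwards [hω (C / ε + 1), eventually_gt_atTop 0] with n hn hn0
      have hn0' : (0 : ℝ) < n := by exact_mod_cast hn0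
      have hS : 0 < birkSumF I n ω := lt_of_le_of_lt (by positivity) hn
      have hJ : ‖birkSumF J n ω‖ ≤ C * n := by
        unfold birkSumF
        refine (norm_sum_le_of_le _ fun i _ => hC _).trans ?_
        simp [mul_comm]
      rw [dist_zero_right, norm_smul, norm_inv, Real.norm_of_nonneg hS.le, inv_mul_lt_iff₀ hS]
      refine hJ.trans_lt ?_
      have h5 : (C / ε + 1) * n * ε < birkSumF I n ω * ε := by gcongr
      have h6 : (C / ε + 1) * n * ε = C * n + n * ε := by field_simp
      have h7 : 0 < (n : ℝ) * ε := by positivity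
      linarith
    exact ⟨key, key.exists⟩
end
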